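/- Let n = 2, ℓ = 2d−2, assume F is nondegenerate, and fix i ∈ {0,1,2}. Then there exists a nonzero θ_i ∈ K, depending only on F and i, such that for every integer m ≥ 0 with d(m+1) ≠ 0 in K and every v ∈ ℤ³ of degree dm + ℓ, there is a K-linear map φ_{v,i} : K[x^±]_{D(v,ℓ)} → K[x^±]_{D(v+e_i,ℓ+1)} satisfying: (a) for every G ∈ K[x^±]_{D(v,ℓ)}, the restriction of φ_{v,i}(G) to D(v,ℓ) equals (v_i+1)·θ_i·G; and (b) if v_i + 1 ≠ 0 in K, then φ_{v,i}(ℰ_{v,ℓ}) ⊆ ℰ_{v+e_i,ℓ+1}. -/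

import Mathlib

noncomputable section

open MvPolynomial

/-- The finset `D_ℓ` of exponent vectors in `ℤ_{≥0}^{n+1}` of total degree `ℓ`,
realized as integer vectors. -/
def Dfin (n ℓ : ℕ) : Finset (Fin (n + 1) → ℤ) :=
  (Finset.Nat.antidiagonalTuple (n + 1) ℓ).image fun t i => (t i : ℤ)

/-- The inverted simplex `D(v,ℓ) = {v - w : w ∈ D_ℓ}`. -/
def Dv {n : ℕ} (v : Fin (n + 1) → ℤ) (ℓ : ℕ) : Finset (Fin (n + 1) → ℤ) :=
  (Dfin n ℓ).image fun w => v - w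

/-- The coefficient of a polynomial at an integer exponent vector (zero if some exponent
is negative). -/
def coeffZ {K : Type*} [Field K] {n : ℕ} (F : MvPolynomial (Fin (n + 1)) K)
    (u : Fin (n + 1) → ℤ) : K :=
  if ∀ i, 0 ≤ u i then
    MvPolynomial.coeff (Finsupp.equivFunOnFinite.symm fun i => (u i).toNat) F
  else 0

/-- The linear functional
`G ↦ Σ_{t ∈ D_d} ((v_i - s_i) - (m+1)·t_i) · F_t · G_{v-s-t}`, i.e. the difference of the
two sides of the defining equation of `ℰ_{v,ℓ}` at `(s,i)`. -/
def eqFun {K : Type*} [Field K] {n : ℕ} (F : MvPolynomial (Fin (n + 1)) K) (d m : ℕ)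
    (v s : Fin (n + 1) → ℤ) (i : Fin (n + 1)) : ((Fin (n + 1) → ℤ) →₀ K) →ₗ[K] K :=
  ∑ t ∈ Dfin n d,
    ((((v i - s i : ℤ) : K) - ((m : K) + 1) * ((t i : ℤ) : K)) * coeffZ F t) •
      (Finsupp.lapply (v - s - t) : ((Fin (n + 1) → ℤ) →₀ K) →ₗ[K] K)

/-- The space `ℰ_{v,ℓ}`: Laurent polynomials `G` supported on `D(v,ℓ)` such that for every
`s ∈ D_{ℓ-d}` and every `i ∈ {0,…,n}`,
`(v_i - s_i) Σ_{t∈D_d} F_t G_{v-s-t} = (m+1) Σ_{t∈D_d} t_i F_t G_{v-s-t}`. -/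
def Espace {K : Type*} [Field K] {n : ℕ} (F : MvPolynomial (Fin (n + 1)) K) (d m : ℕ)
    (v : Fin (n + 1) → ℤ) (ℓ : ℕ) : Submodule K ((Fin (n + 1) → ℤ) →₀ K) :=
  Finsupp.supported K K ↑(Dv v ℓ) ⊓
    ⨅ s ∈ Dfin n (ℓ - d), ⨅ i : Fin (n + 1), LinearMap.ker (eqFun F d m v s i)

/-- Restriction `G|_S` of a Laurent polynomial to a finite set of monomials. -/
def restrictF {K : Type*} [Field K] {n : ℕ} (G : (Fin (n + 1) → ℤ) →₀ K)
    (S : Finset (Fin (n + 1) → ℤ)) : (Fin (n + 1) → ℤ) →₀ K :=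
  ∑ u ∈ S, Finsupp.single u (G u)

/-- Restriction `F|_S` of a polynomial to a finite set of (integer) monomials, as a Laurent
polynomial. -/
def restrictPoly {K : Type*} [Field K] {n : ℕ} (F : MvPolynomial (Fin (n + 1)) K)
    (S : Finset (Fin (n + 1) → ℤ)) : (Fin (n + 1) → ℤ) →₀ K :=
  ∑ u ∈ S, Finsupp.single u (coeffZ F u)

/-- The coefficient of the product `F·G` at the integer exponent vector `w`, where `F` is a
polynomial and `G` a Laurent polynomial. -/
def mulCoeffZ {K : Type*} [Field K] {n : ℕ} (F : MvPolynomial (Fin (n + 1)) K)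
    (G : (Fin (n + 1) → ℤ) →₀ K) (w : Fin (n + 1) → ℤ) : K :=
  ∑ t ∈ F.support, MvPolynomial.coeff t F * G fun i => w i - (t i : ℤ)

theorem mem_Dfin {n ℓ : ℕ} {t : Fin (n + 1) → ℤ} :
    t ∈ Dfin n ℓ ↔ (∀ l, 0 ≤ t l) ∧ ∑ l, t l = ℓ := by
  simp only [Dfin, Finset.mem_image, Finset.Nat.mem_antidiagonalTuple]
  constructor
  · rintro ⟨a, ha, rfl⟩
    exact ⟨fun l => by positivity, by simpa using congrArg (Nat.cast : ℕ → ℤ) ha⟩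
  · rintro ⟨h0, hs⟩
    refine ⟨fun l => (t l).toNat, ?_, ?_⟩
    · zify
      rw [← hs]
      exact Finset.sum_congr rfl fun l _ => Int.toNat_of_nonneg (h0 l)
    · ext l
      exact Int.toNat_of_nonneg (h0 l)

theorem mem_Dv {n ℓ : ℕ} {v u : Fin (n + 1) → ℤ} : u ∈ Dv v ℓ ↔ v - u ∈ Dfin n ℓ := by
  simp only [Dv, Finset.mem_image]
  constructor
  · rintro ⟨w, hw, rfl⟩
    simpa using hw
  · intro h
    exact ⟨v - u, h, by simp⟩

theorem Dv_subset_Dv_add_single {n ℓ ℓ' : ℕ} (v : Fin (n + 1) → ℤ) (i : Fin (n + 1))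
    (hℓ : ℓ' = ℓ + 1) : Dv v ℓ ⊆ Dv (v + Pi.single i 1) ℓ' := by
  intro u hu
  rw [mem_Dv, mem_Dfin] at hu ⊢
  have hadd : v + Pi.single i 1 - u = v - u + Pi.single i 1 := by abel
  rw [hadd]
  refine ⟨fun l => ?_, ?_⟩
  · have h1 : (0 : ℤ) ≤ (Pi.single i 1 : Fin (n + 1) → ℤ) l := by
      rw [Pi.single_apply]
      positivity
    exact add_nonneg (hu.1 l) h1
  · simp only [Pi.add_apply, Finset.sum_add_distrib, hu.2, Finset.sum_pi_single', Finset.mem_univ,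
      if_true, hℓ, Nat.cast_add, Nat.cast_one]

theorem restrictF_apply {K : Type*} [Field K] {n : ℕ} (G : (Fin (n + 1) → ℤ) →₀ K)
    (S : Finset (Fin (n + 1) → ℤ)) (u : Fin (n + 1) → ℤ) :
    restrictF G S u = if u ∈ S then G u else 0 := by
  classical
  simp [restrictF, Finsupp.finsetSum_apply, Finsupp.single_apply]

theorem eqFun_apply {K : Type*} [Field K] {n : ℕ} (F : MvPolynomial (Fin (n + 1)) K) (d m : ℕ)
    (v s : Fin (n + 1) → ℤ) (l : Fin (n + 1)) (G : (Fin (n + 1) → ℤ) →₀ K) :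
    eqFun F d m v s l G =
      ((v l - s l : ℤ) : K) * ∑ t ∈ Dfin n d, coeffZ F t * G (v - s - t) -
        ((m : K) + 1) * ∑ t ∈ Dfin n d, ((t l : ℤ) : K) * (coeffZ F t * G (v - s - t)) := by
  simp only [eqFun, LinearMap.sum_apply, LinearMap.smul_apply, Finsupp.lapply_apply, smul_eq_mul,
    Finset.mul_sum, ← Finset.sum_sub_distrib]
  exact Finset.sum_congr rfl fun t _ => by ring

theorem mem_Espace {K : Type*} [Field K] {n : ℕ} {F : MvPolynomial (Fin (n + 1)) K} {d m ℓ : ℕ}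
    {v : Fin (n + 1) → ℤ} {G : (Fin (n + 1) → ℤ) →₀ K} :
    G ∈ Espace F d m v ℓ ↔ G ∈ Finsupp.supported K K (Dv v ℓ : Set (Fin (n + 1) → ℤ)) ∧
      ∀ s ∈ Dfin n (ℓ - d), ∀ l, eqFun F d m v s l G = 0 := by
  simp [Espace, Submodule.mem_iInf]

/-- The transpose of the Sylvester map of two coprime polynomials is surjective. -/
theorem IsCoprime.exists_linearMap_X_pow_mul {K : Type*} [Field K] {d : ℕ} {P Q : Polynomial K}
    (hP : P.degree = d) (hPQ : IsCoprime P Q) (α β : ℕ → K) :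
    ∃ η : Polynomial K →ₗ[K] K, ∀ p < d,
      η (Polynomial.X ^ p * P) = α p ∧ η (Polynomial.X ^ p * Q) = β p := by
  have hP0 : P ≠ 0 := by
    rintro rfl
    simp at hP
  let S : Polynomial.degreeLT K d × Polynomial.degreeLT K d →ₗ[K] Polynomial K :=
    (LinearMap.mulRight K P ∘ₗ (Polynomial.degreeLT K d).subtype).coprod
      (LinearMap.mulRight K Q ∘ₗ (Polynomial.degreeLT K d).subtype)
  have hS : LinearMap.ker S = ⊥ := by
    rw [LinearMap.ker_eq_bot']
    rintro ⟨⟨a, ha⟩, ⟨b, hb⟩⟩ hab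
    have hab' : a * P + b * Q = 0 := by simpa [S] using hab
    have hdvd : P ∣ b := by
      refine hPQ.dvd_of_dvd_mul_right ⟨-a, ?_⟩
      linear_combination hab'
    have hb0 : b = 0 := Polynomial.eq_zero_of_dvd_of_degree_lt hdvd
      (hP ▸ Polynomial.mem_degreeLT.mp hb)
    subst hb0
    have ha0 : a = 0 := by simpa [hP0] using hab'
    subst ha0
    rfl
  obtain ⟨L, hL⟩ := S.exists_leftInverse_of_injective hS
  let coeffSum (γ : ℕ → K) : Polynomial.degreeLT K d →ₗ[K] K :=
    (∑ p ∈ Finset.range d, γ p • Polynomial.lcoeff K p) ∘ₗ (Polynomial.degreeLT K d).subtype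
  refine ⟨((coeffSum α).coprod (coeffSum β)) ∘ₗ L, fun p hp => ?_⟩
  have hX : (Polynomial.X ^ p : Polynomial K) ∈ Polynomial.degreeLT K d := by
    rw [Polynomial.mem_degreeLT, Polynomial.degree_X_pow]
    exact_mod_cast hp
  have h₁ : L (Polynomial.X ^ p * P) = (⟨_, hX⟩, 0) := by
    simpa [S] using LinearMap.congr_fun hL (⟨_, hX⟩, 0)
  have h₂ : L (Polynomial.X ^ p * Q) = (0, ⟨_, hX⟩) := by
    simpa [S] using LinearMap.congr_fun hL (0, ⟨_, hX⟩)
  simp [h₁, h₂, coeffSum, Polynomial.coeff_X_pow, hp]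

/-- If every element of `E` can be corrected by an element of `N` so as to lie in `A`, then the
correction can be chosen linearly. -/
theorem Submodule.exists_linearMap_add_mem {K V : Type*} [Field K] [AddCommGroup V] [Module K V]
    {E A N : Submodule K V} (h : ∀ x ∈ E, ∃ y ∈ N, x + y ∈ A) :
    ∃ g : V →ₗ[K] N, ∀ x ∈ E, x + g x ∈ A := by
  let q : N →ₗ[K] V ⧸ A := A.mkQ ∘ₗ N.subtype
  have hr : ∀ x : E, (-(A.mkQ ∘ₗ E.subtype)) x ∈ LinearMap.range q := by
    rintro ⟨x, hx⟩
    obtain ⟨y, hy, hxy⟩ := h x hx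
    refine ⟨⟨y, hy⟩, ?_⟩
    simp only [q, LinearMap.comp_apply, LinearMap.neg_apply, Submodule.subtype_apply]
    rw [eq_neg_iff_add_eq_zero, ← map_add, Submodule.mkQ_apply, Submodule.Quotient.mk_eq_zero,
      add_comm]
    exact hxy
  obtain ⟨f, hf⟩ := Module.projective_lifting_property q.rangeRestrict
    ((-(A.mkQ ∘ₗ E.subtype)).codRestrict _ hr) q.surjective_rangeRestrict
  obtain ⟨g, hg⟩ := LinearMap.exists_extend f
  refine ⟨g, fun x hx => ?_⟩
  have h₁ : g x = f ⟨x, hx⟩ := LinearMap.congr_fun hg ⟨x, hx⟩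
  have h₂ : A.mkQ (f ⟨x, hx⟩ : V) = -A.mkQ x :=
    congrArg Subtype.val (LinearMap.congr_fun hf ⟨x, hx⟩)
  rw [h₁, ← Submodule.Quotient.mk_eq_zero, ← Submodule.mkQ_apply, map_add, h₂, add_neg_cancel]

theorem eq_or_eq_or_eq_of_ne {i j k : Fin (2 + 1)} (hij : i ≠ j) (hik : i ≠ k) (hjk : j ≠ k)
    (l : Fin (2 + 1)) : l = i ∨ l = j ∨ l = k := by
  revert i j k l
  decide

theorem sum_fin_three_of_ne {M : Type*} [AddCommMonoid M] {i j k : Fin (2 + 1)} (hij : i ≠ j)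
    (hik : i ≠ k) (hjk : j ≠ k) (g : Fin (2 + 1) → M) : ∑ l, g l = g i + (g j + g k) := by
  have : (Finset.univ : Finset (Fin (2 + 1))) = {i, j, k} := by
    revert i j k
    decide
  rw [this, Finset.sum_insert (by simp [hij, hik]), Finset.sum_pair hjk]

theorem edge_mem_Dfin {j k : Fin (2 + 1)} {a b ℓ : ℕ} (h : a + b = ℓ) :
    (Pi.single j (a : ℤ) + Pi.single k (b : ℤ) : Fin (2 + 1) → ℤ) ∈ Dfin 2 ℓ := by
  rw [mem_Dfin]
  refine ⟨fun l => ?_, ?_⟩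
  · simp only [Pi.add_apply, Pi.single_apply]
    positivity
  · simp [Finset.sum_add_distrib, ← h]

theorem eq_edge {i j k : Fin (2 + 1)} (hij : i ≠ j) (hik : i ≠ k) (hjk : j ≠ k) {ℓ : ℕ}
    {t : Fin (2 + 1) → ℤ} (ht : t ∈ Dfin 2 ℓ) (hti : t i = 0) :
    ∃ q ≤ ℓ, t = Pi.single j (q : ℤ) + Pi.single k ((ℓ - q : ℕ) : ℤ) := by
  obtain ⟨h0, hs⟩ := mem_Dfin.mp ht
  rw [sum_fin_three_of_ne hij hik hjk] at hs
  have hj := h0 j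
  have hk := h0 k
  refine ⟨(t j).toNat, by omega, ?_⟩
  ext l
  rcases eq_or_eq_or_eq_of_ne hij hik hjk l with rfl | rfl | rfl
  · simp [hij, hik, hti]
  · simp [hjk, hj]
  · simp [hjk.symm]
    omega

theorem sum_Dfin_eq_sum_edge {M : Type*} [AddCommMonoid M] {i j k : Fin (2 + 1)} (hij : i ≠ j)
    (hik : i ≠ k) (hjk : j ≠ k) (ℓ : ℕ) (h : (Fin (2 + 1) → ℤ) → M)
    (hh : ∀ t ∈ Dfin 2 ℓ, 0 < t i → h t = 0) :
    ∑ t ∈ Dfin 2 ℓ, h t =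
      ∑ q ∈ Finset.range (ℓ + 1), h (Pi.single j (q : ℤ) + Pi.single k ((ℓ - q : ℕ) : ℤ)) := by
  symm
  refine Finset.sum_of_injOn (fun q : ℕ => Pi.single j (q : ℤ) + Pi.single k ((ℓ - q : ℕ) : ℤ))
    ?_ ?_ ?_ fun q _ => rfl
  · intro a _ b _ hab
    simpa [Pi.single_apply, hjk] using congrFun hab j
  · intro q hq
    have := Finset.mem_range.mp hq
    exact edge_mem_Dfin (by omega)
  · intro t ht hne
    refine hh t ht (lt_of_le_of_ne ((mem_Dfin.mp ht).1 i) fun h0 => hne ?_)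
    obtain ⟨q, hq, rfl⟩ := eq_edge hij hik hjk ht h0.symm
    exact ⟨q, by simpa using Nat.lt_succ_of_le hq, rfl⟩

theorem aeval_X_mul_pderiv_eq_sum {K L : Type*} [Field K] [Field L] [Algebra K L] {n d : ℕ}
    {F : MvPolynomial (Fin (n + 1)) K} (hF : F.IsHomogeneous d) (x : Fin (n + 1) → L)
    (l : Fin (n + 1)) :
    aeval x (X l * pderiv l F) =
      ∑ t ∈ Dfin n d, algebraMap K L (((t l : ℤ) : K) * coeffZ F t) * ∏ r, x r ^ (t r).toNat := by
  have hterm : aeval x (X l * pderiv l F) = ∑ t ∈ F.support,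
      algebraMap K L ((t l : K) * coeff t F) * ∏ r, x r ^ t r := by
    conv_lhs => rw [F.as_sum]
    simp only [map_sum, Finset.mul_sum]
    refine Finset.sum_congr rfl fun t _ => ?_
    rw [X_mul_pderiv_monomial, map_nsmul, aeval_monomial, Finsupp.prod_fintype _ _ (by simp)]
    simp [mul_assoc]
  rw [hterm]
  refine Finset.sum_of_injOn (fun t r => (t r : ℤ)) ?_ ?_ ?_ ?_
  · intro a _ b _ hab
    ext r
    simpa using congrFun hab r
  · intro t ht
    have hdeg := hF (mem_support_iff.mp ht)
    rw [Finset.mem_coe, mem_Dfin]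
    refine ⟨fun r => by positivity, ?_⟩
    rw [← hdeg, Finsupp.weight_apply, Finsupp.sum_fintype _ _ (by simp)]
    simp
  · intro t ht hne
    have h0 := (mem_Dfin.mp ht).1
    have hc : coeffZ F t = 0 := by
      rw [coeffZ, if_pos h0]
      by_contra hc
      refine hne ⟨_, mem_support_iff.mpr hc, ?_⟩
      ext r
      simp [h0 r]
    simp [hc]
  · intro t _
    have hc : coeffZ F (fun r => (t r : ℤ)) = coeff t F := by
      rw [coeffZ, if_pos fun r => by positivity]
      congr 1
      ext r
      simp
    simp [hc]

/-- The binary form `∂_l F` on the edge `x_i = 0`, dehomogenized with respect to `x_k`. -/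
def edgePoly {K : Type*} [Field K] (F : MvPolynomial (Fin (2 + 1)) K) (d : ℕ)
    (j k l : Fin (2 + 1)) : Polynomial K :=
  ∑ q ∈ Finset.range (d + 1), Polynomial.C
    ((((Pi.single j (q : ℤ) + Pi.single k ((d - q : ℕ) : ℤ) : Fin (2 + 1) → ℤ) l : ℤ) : K) *
      coeffZ F (Pi.single j (q : ℤ) + Pi.single k ((d - q : ℕ) : ℤ))) * Polynomial.X ^ q

theorem coeff_edgePoly {K : Type*} [Field K] (F : MvPolynomial (Fin (2 + 1)) K) {d q : ℕ}
    (hq : q ≤ d) (j k l : Fin (2 + 1)) : (edgePoly F d j k l).coeff q =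
      (((Pi.single j (q : ℤ) + Pi.single k ((d - q : ℕ) : ℤ) : Fin (2 + 1) → ℤ) l : ℤ) : K) *
        coeffZ F (Pi.single j (q : ℤ) + Pi.single k ((d - q : ℕ) : ℤ)) := by
  simp only [edgePoly, Polynomial.finsetSum_coeff, Polynomial.coeff_C_mul_X_pow]
  rw [Finset.sum_ite_eq, if_pos (Finset.mem_range.mpr (Nat.lt_succ_of_le hq))]

theorem aeval_edge_X_mul_pderiv {K L : Type*} [Field K] [Field L] [Algebra K L] {d : ℕ}
    {F : MvPolynomial (Fin (2 + 1)) K} (hF : F.IsHomogeneous d) {i j k : Fin (2 + 1)}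
    (hij : i ≠ j) (hik : i ≠ k) (hjk : j ≠ k) (y z : L) (l : Fin (2 + 1)) :
    aeval (Pi.single j y + Pi.single k z : Fin (2 + 1) → L) (X l * pderiv l F) =
      ∑ q ∈ Finset.range (d + 1), algebraMap K L ((edgePoly F d j k l).coeff q) *
        (y ^ q * z ^ (d - q)) := by
  rw [aeval_X_mul_pderiv_eq_sum hF, sum_Dfin_eq_sum_edge hij hik hjk]
  · refine Finset.sum_congr rfl fun q hq => ?_
    congr 1
    · rw [coeff_edgePoly F (Nat.lt_succ_iff.mp (Finset.mem_range.mp hq))]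
    · rw [Fintype.prod_eq_mul j k hjk]
      · simp [hjk, hjk.symm]
      · rintro r ⟨hrj, hrk⟩
        simp [hrj, hrk]
  · intro t _ hti
    rw [Finset.prod_eq_zero (Finset.mem_univ i), mul_zero]
    rw [Pi.add_apply, Pi.single_eq_of_ne hij, Pi.single_eq_of_ne hik, add_zero]
    exact zero_pow (by omega)

theorem natDegree_edgePoly_le {K : Type*} [Field K] (F : MvPolynomial (Fin (2 + 1)) K) (d : ℕ)
    (j k l : Fin (2 + 1)) : (edgePoly F d j k l).natDegree ≤ d :=
  Polynomial.natDegree_sum_le_of_forall_le _ _ fun q hq =>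
    (Polynomial.natDegree_C_mul_X_pow_le _ q).trans (Nat.lt_succ_iff.mp (Finset.mem_range.mp hq))

theorem edgePoly_eq_zero {K : Type*} [Field K] (F : MvPolynomial (Fin (2 + 1)) K) (d : ℕ)
    {i j k : Fin (2 + 1)} (hij : i ≠ j) (hik : i ≠ k) : edgePoly F d j k i = 0 := by
  simp [edgePoly, hij, hik]

theorem degree_edgePoly {K : Type*} [Field K] {d : ℕ} {F : MvPolynomial (Fin (2 + 1)) K}
    (hF : F.IsHomogeneous d)
    (hnd : ∀ x : Fin (2 + 1) → AlgebraicClosure K,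
      (∀ j, MvPolynomial.aeval x (X j * pderiv j F) = 0) → x = 0)
    {i j k : Fin (2 + 1)} (hij : i ≠ j) (hik : i ≠ k) (hjk : j ≠ k) :
    (edgePoly F d j k j).degree = d := by
  have hcoeff : (edgePoly F d j k j).coeff d ≠ 0 := by
    intro h0
    have hx := hnd (Pi.single j 1 + Pi.single k 0) fun l => ?_
    · simpa [Pi.single_apply, hjk] using congrFun hx j
    rw [aeval_edge_X_mul_pderiv hF hij hik hjk, Finset.sum_range_succ, Finset.sum_eq_zero]
    · rcases eq_or_eq_or_eq_of_ne hij hik hjk l with rfl | rfl | rfl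
      · simp [edgePoly_eq_zero F d hij hik]
      · simp [h0]
      · simp [coeff_edgePoly F le_rfl, hjk.symm]
    · intro q hq
      have := Finset.mem_range.mp hq
      rw [zero_pow (by omega), mul_zero, mul_zero]
  exact Polynomial.degree_eq_of_le_of_coeff_ne_zero
    (Polynomial.degree_le_of_natDegree_le (natDegree_edgePoly_le F d j k j)) hcoeff

theorem isCoprime_edgePoly {K : Type*} [Field K] {d : ℕ} {F : MvPolynomial (Fin (2 + 1)) K}
    (hF : F.IsHomogeneous d)
    (hnd : ∀ x : Fin (2 + 1) → AlgebraicClosure K,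
      (∀ j, MvPolynomial.aeval x (X j * pderiv j F) = 0) → x = 0)
    {i j k : Fin (2 + 1)} (hij : i ≠ j) (hik : i ≠ k) (hjk : j ≠ k) :
    IsCoprime (edgePoly F d j k j) (edgePoly F d j k k) := by
  rw [Polynomial.isCoprime_iff_aeval_ne_zero_of_isAlgClosed K (AlgebraicClosure K)]
  intro y
  by_contra! h
  have hx := hnd (Pi.single j y + Pi.single k 1) fun l => ?_
  · simpa [Pi.single_apply, hjk.symm] using congrFun hx k
  have haeval : aeval (Pi.single j y + Pi.single k 1 : Fin (2 + 1) → AlgebraicClosure K)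
      (X l * pderiv l F) = Polynomial.aeval y (edgePoly F d j k l) := by
    rw [aeval_edge_X_mul_pderiv hF hij hik hjk, Polynomial.aeval_eq_sum_range'
      (Nat.lt_succ_of_le (natDegree_edgePoly_le F d j k l))]
    simp [Algebra.smul_def]
  rw [haeval]
  rcases eq_or_eq_or_eq_of_ne hij hik hjk l with rfl | rfl | rfl
  · simp [edgePoly_eq_zero F d hij hik]
  · exact h.1
  · exact h.2

theorem linearMap_X_pow_mul_edgePoly {K : Type*} [Field K] (F : MvPolynomial (Fin (2 + 1)) K)
    (d : ℕ) (j k l : Fin (2 + 1)) (η : Polynomial K →ₗ[K] K) (p : ℕ) :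
    η (Polynomial.X ^ p * edgePoly F d j k l) = ∑ q ∈ Finset.range (d + 1),
      (((Pi.single j (q : ℤ) + Pi.single k ((d - q : ℕ) : ℤ) : Fin (2 + 1) → ℤ) l : ℤ) : K) *
        (coeffZ F (Pi.single j (q : ℤ) + Pi.single k ((d - q : ℕ) : ℤ)) *
          η (Polynomial.X ^ (p + q))) := by
  rw [edgePoly, Finset.mul_sum, map_sum]
  refine Finset.sum_congr rfl fun q _ => ?_
  rw [mul_left_comm, ← pow_add, ← Polynomial.smul_eq_C_mul, map_smul, smul_eq_mul, mul_assoc]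

theorem natCast_mul_sum_Dfin {K : Type*} [Field K] (n d : ℕ) (h : (Fin (n + 1) → ℤ) → K) :
    (d : K) * ∑ t ∈ Dfin n d, h t = ∑ l, ∑ t ∈ Dfin n d, ((t l : ℤ) : K) * h t := by
  rw [Finset.sum_comm, Finset.mul_sum]
  refine Finset.sum_congr rfl fun t ht => ?_
  rw [← Finset.sum_mul, ← Int.cast_sum, (mem_Dfin.mp ht).2, Int.cast_natCast]

theorem exists_add_mem_Espace {K : Type*} [Field K] {d : ℕ} (hd : 2 ≤ d)
    {F : MvPolynomial (Fin (2 + 1)) K} (hF : F.IsHomogeneous d)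
    (hnd : ∀ x : Fin (2 + 1) → AlgebraicClosure K,
      (∀ j, MvPolynomial.aeval x (X j * pderiv j F) = 0) → x = 0)
    {i j k : Fin (2 + 1)} (hij : i ≠ j) (hik : i ≠ k) (hjk : j ≠ k) {m : ℕ}
    (hdK : (d : K) ≠ 0) {v : Fin (2 + 1) → ℤ}
    (hv : (∑ l, v l) = ((d * m + (2 * d - 2) : ℕ) : ℤ)) (hvi : ((v i + 1 : ℤ) : K) ≠ 0)
    {G : (Fin (2 + 1) → ℤ) →₀ K} (hG : G ∈ Espace F d m v (2 * d - 2)) :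
    ∃ N ∈ Finsupp.supported K K
        {u | u ∈ Dv (v + Pi.single i 1) (2 * d - 1) ∧ u i = v i + 1},
      G + N ∈ Espace F d m (v + Pi.single i 1) (2 * d - 1) := by
  classical
  obtain ⟨hGs, hGe⟩ := mem_Espace.mp hG
  set v' : Fin (2 + 1) → ℤ := v + Pi.single i 1 with hv'
  have hv'i : v' i = v i + 1 := by simp [hv']
  let edge (p : ℕ) : Fin (2 + 1) → ℤ := Pi.single j (p : ℤ) + Pi.single k ((d - 1 - p : ℕ) : ℤ)
  let g (p : ℕ) (l : Fin (2 + 1)) : K :=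
    ∑ t ∈ Dfin 2 d, ((t l : ℤ) : K) * (coeffZ F t * G (v' - edge p - t))
  let γ (l : Fin (2 + 1)) (p : ℕ) : K :=
    ((v l - edge p l : ℤ) : K) * (g p i / ((v i + 1 : ℤ) : K)) - g p l
  obtain ⟨η, hη⟩ := (isCoprime_edgePoly hF hnd hij hik hjk).exists_linearMap_X_pow_mul
    (degree_edgePoly hF hnd hij hik hjk) (γ j) (γ k)
  let N : (Fin (2 + 1) → ℤ) →₀ K := Finsupp.onFinset (Dv v' (2 * d - 1))
    (fun u => if u ∈ Dv v' (2 * d - 1) ∧ u i = v i + 1 then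
      η (Polynomial.X ^ ((v' - u) j).toNat) else 0)
    (fun u hu => by
      by_contra h
      simp [h] at hu)
  have hNapply (u) : N u = if u ∈ Dv v' (2 * d - 1) ∧ u i = v i + 1 then
      η (Polynomial.X ^ ((v' - u) j).toNat) else 0 := rfl
  have hN0 (u) (hu : u i ≠ v i + 1) : N u = 0 := by simp [hNapply, hu]
  have hNs : N ∈ Finsupp.supported K K {u | u ∈ Dv v' (2 * d - 1) ∧ u i = v i + 1} := by
    rw [Finsupp.mem_supported]
    intro u hu
    by_contra h
    rw [Finset.mem_coe, Finsupp.mem_support_iff, hNapply] at hu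
    exact hu (if_neg h)
  refine ⟨N, hNs, mem_Espace.mpr ⟨Submodule.add_mem _ ?_ ?_, fun s hs l => ?_⟩⟩
  · exact Finsupp.supported_mono (fun u hu => Dv_subset_Dv_add_single v i (by omega) hu) hGs
  · exact Finsupp.supported_mono (fun u hu => hu.1) hNs
  have hs0 := (mem_Dfin.mp hs).1
  rw [map_add]
  rcases (hs0 i).lt_or_eq with hsi | hsi
  · have h1 : eqFun F d m v' s l N = 0 := by
      have hz : ∀ t ∈ Dfin 2 d, N (v' - s - t) = 0 := fun t ht => hN0 _ (by
        have := (mem_Dfin.mp ht).1 i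
        simp only [Pi.sub_apply, hv'i]
        omega)
      rw [eqFun_apply, Finset.sum_eq_zero, Finset.sum_eq_zero]
      · ring
      · intro t ht
        rw [hz t ht, mul_zero, mul_zero]
      · intro t ht
        rw [hz t ht, mul_zero]
    have h2 : eqFun F d m v' s l G = eqFun F d m v (s - Pi.single i 1) l G := by
      have hvs : v' - s = v - (s - Pi.single i 1) := by rw [hv']; abel
      have hvsl : v' l - s l = v l - (s - Pi.single i 1 : Fin (2 + 1) → ℤ) l := congrFun hvs l
      rw [eqFun_apply, eqFun_apply, hvs, hvsl]
    rw [h1, h2, add_zero]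
    refine hGe _ (mem_Dfin.mpr ⟨fun r => ?_, ?_⟩) l
    · have := hs0 r
      rw [Pi.sub_apply, Pi.single_apply]
      split_ifs with hr
      · subst hr
        omega
      · simpa using this
    · have := (mem_Dfin.mp hs).2
      simp only [Pi.sub_apply, Finset.sum_sub_distrib, Finset.sum_pi_single', Finset.mem_univ,
        if_true]
      omega
  · obtain ⟨p, hp, rfl⟩ := eq_edge hij hik hjk hs hsi.symm
    have hd1 : 2 * d - 1 - d = d - 1 := by omega
    rw [hd1] at hp ⊢
    change eqFun F d m v' (edge p) l G + eqFun F d m v' (edge p) l N = 0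
    have hei : edge p i = 0 := by simp [edge, hij, hik]
    have hej : edge p j = p := by simp [edge, hjk]
    have hek : edge p k = (d - 1 - p : ℕ) := by simp [edge, hjk.symm]
    have hNedge (q : ℕ) (hq : q ∈ Finset.range (d + 1)) :
        N (v' - edge p - (Pi.single j (q : ℤ) + Pi.single k ((d - q : ℕ) : ℤ))) =
          η (Polynomial.X ^ (p + q)) := by
      have hq' := Finset.mem_range.mp hq
      have hsum : edge p + (Pi.single j (q : ℤ) + Pi.single k ((d - q : ℕ) : ℤ)) =
          Pi.single j ((p + q : ℕ) : ℤ) + Pi.single k ((2 * d - 1 - (p + q) : ℕ) : ℤ) := by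
        have h3 : ((2 * d - 1 - (p + q) : ℕ) : ℤ) = (d - 1 - p : ℕ) + (d - q : ℕ) := by omega
        rw [h3, Nat.cast_add, Pi.single_add, Pi.single_add]
        simp only [edge]
        abel
      rw [sub_sub, hsum, hNapply, if_pos]
      · have hj' : ((Pi.single j ((p + q : ℕ) : ℤ) : Fin (2 + 1) → ℤ) j).toNat = p + q := by
          rw [Pi.single_eq_same, Int.toNat_natCast]
        rw [sub_sub_cancel, Pi.add_apply, Pi.single_eq_of_ne hjk, add_zero, hj']
      · refine ⟨?_, by simp [hij, hik, hv'i]⟩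
        rw [mem_Dv, sub_sub_cancel]
        exact edge_mem_Dfin (by omega)
    have hNl (r : Fin (2 + 1)) :
        ∑ t ∈ Dfin 2 d, ((t r : ℤ) : K) * (coeffZ F t * N (v' - edge p - t)) =
          η (Polynomial.X ^ p * edgePoly F d j k r) := by
      rw [linearMap_X_pow_mul_edgePoly, sum_Dfin_eq_sum_edge hij hik hjk]
      · exact Finset.sum_congr rfl fun q hq => by rw [hNedge q hq]
      · intro t _ ht
        rw [hN0 _ (by simp only [Pi.sub_apply, hv'i, hei]; omega), mul_zero, mul_zero]
    have hGsum := natCast_mul_sum_Dfin 2 d fun t => coeffZ F t * G (v' - edge p - t)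
    have hNsum := natCast_mul_sum_Dfin 2 d fun t => coeffZ F t * N (v' - edge p - t)
    rw [sum_fin_three_of_ne hij hik hjk] at hGsum hNsum
    obtain ⟨hj, hk⟩ := hη p (by omega)
    rw [hNl, hNl, hNl, hj, hk, edgePoly_eq_zero F d hij hik, mul_zero, map_zero, zero_add] at hNsum
    rw [eqFun_apply, eqFun_apply, hNl]
    change _ = g p i + (g p j + g p k) at hGsum
    change _ * _ - _ * g p l + _ = 0
    set g₀ := ∑ t ∈ Dfin 2 d, coeffZ F t * G (v' - edge p - t)
    set n₀ := ∑ t ∈ Dfin 2 d, coeffZ F t * N (v' - edge p - t)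
    obtain ⟨B, hB⟩ : ∃ B, B = g p i / ((v i + 1 : ℤ) : K) := ⟨_, rfl⟩
    have hBi : g p i = ((v i + 1 : ℤ) : K) * B := by rw [hB, mul_div_cancel₀ _ hvi]
    have hγ (r) : γ r p = ((v r - edge p r : ℤ) : K) * B - g p r := by rw [hB]
    have hdeg : ((v i + 1 : ℤ) : K) + ((v j - edge p j : ℤ) : K) + ((v k - edge p k : ℤ) : K) =
        d * (m + 1) := by
      rw [sum_fin_three_of_ne hij hik hjk] at hv
      have hz : (v i + 1) + (v j - edge p j) + (v k - edge p k) = (d : ℤ) * (m + 1) := by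
        rw [hej, hek]
        have h4 : ((d * m + (2 * d - 2) : ℕ) : ℤ) = d * m + (2 * d - 2) := by
          push_cast [show 2 ≤ 2 * d by omega]
          ring
        rw [h4] at hv
        have h5 : ((d - 1 - p : ℕ) : ℤ) = d - 1 - p := by omega
        rw [h5]
        linarith
      exact_mod_cast congrArg (Int.cast : ℤ → K) hz
    have h₀ : g₀ + n₀ = (m + 1) * B := by
      refine mul_left_cancel₀ hdK ?_
      rw [mul_add, hGsum, hNsum, hγ, hγ, hBi]
      linear_combination B * hdeg
    have hv'ne {r} (hr : i ≠ r) : v' r = v r := by simp [hv', hr.symm]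
    rcases eq_or_eq_or_eq_of_ne hij hik hjk l with rfl | rfl | rfl
    · rw [edgePoly_eq_zero F d hij hik, mul_zero, map_zero, hv'i, hei, sub_zero, hBi]
      linear_combination ((v l + 1 : ℤ) : K) * h₀
    · rw [hj, hγ, hv'ne hij]
      linear_combination ((v l - edge p l : ℤ) : K) * h₀
    · rw [hk, hγ, hv'ne hik]
      linear_combination ((v l - edge p l : ℤ) : K) * h₀

/-- Lemma 4.2: for `n = 2`, `ℓ = 2d - 2`, `F` nondegenerate, and `i ∈ {0,1,2}`, there is a
nonzero `θ_i ∈ K` (depending only on `F` and `i`) such that for every `m ≥ 0` with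
`d(m+1) ≠ 0` in `K` and every `v ∈ ℤ³` of degree `dm + ℓ`, there is a `K`-linear map
`φ_{v,i} : K[x^±]_{D(v,ℓ)} → K[x^±]_{D(v+e_i,ℓ+1)}` whose output restricted to `D(v,ℓ)`
equals `(v_i+1)·θ_i·G`, and with `φ_{v,i}(ℰ_{v,ℓ}) ⊆ ℰ_{v+e_i,ℓ+1}` whenever
`v_i + 1 ≠ 0` in `K`. -/
theorem exists_extension_map_phi {K : Type*} [Field K]
    (d : ℕ) (hd : 2 ≤ d) (hdK : (d : K) ≠ 0)
    (F : MvPolynomial (Fin (2 + 1)) K) (hF : F.IsHomogeneous d)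
    (hnd : ∀ x : Fin (2 + 1) → AlgebraicClosure K,
      (∀ j, MvPolynomial.aeval x (X j * pderiv j F) = 0) → x = 0)
    (i : Fin (2 + 1)) :
    ∃ θ : K, θ ≠ 0 ∧
      ∀ m : ℕ, (d : K) * ((m : K) + 1) ≠ 0 →
      ∀ v : Fin (2 + 1) → ℤ, (∑ j, v j) = ((d * m + (2 * d - 2) : ℕ) : ℤ) →
      ∃ φ : ((Fin (2 + 1) → ℤ) →₀ K) →ₗ[K] ((Fin (2 + 1) → ℤ) →₀ K),
        (∀ G : (Fin (2 + 1) → ℤ) →₀ K,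
            ↑G.support ⊆ (↑(Dv v (2 * d - 2)) : Set (Fin (2 + 1) → ℤ)) →
            ↑(φ G).support ⊆
                (↑(Dv (v + Pi.single i 1) (2 * d - 1)) : Set (Fin (2 + 1) → ℤ))
              ∧ restrictF (φ G) (Dv v (2 * d - 2)) = (((v i + 1 : ℤ) : K) * θ) • G)
        ∧ (((v i + 1 : ℤ) : K) ≠ 0 →
            ∀ G ∈ Espace F d m v (2 * d - 2),
              φ G ∈ Espace F d m (v + Pi.single i 1) (2 * d - 1)) := by
  obtain ⟨j, k, hij, hik, hjk⟩ : ∃ j k : Fin (2 + 1), i ≠ j ∧ i ≠ k ∧ j ≠ k := by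
    revert i
    decide
  refine ⟨1, one_ne_zero, fun m _ v hv => ?_⟩
  by_cases hvi : ((v i + 1 : ℤ) : K) = 0
  · refine ⟨0, fun G _ => ⟨by simp, ?_⟩, fun h => absurd hvi h⟩
    ext u
    simp [restrictF_apply, hvi]
  obtain ⟨g, hg⟩ := Submodule.exists_linearMap_add_mem fun G hG =>
    exists_add_mem_Espace hd hF hnd hij hik hjk hdK hv hvi (G := G) (m := m) hG
  refine ⟨((v i + 1 : ℤ) : K) • (LinearMap.id + Submodule.subtype _ ∘ₗ g), fun G hG => ⟨?_, ?_⟩,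
    fun _ G hG => Submodule.smul_mem _ _ (hg G hG)⟩
  · rw [← Finsupp.mem_supported K]
    exact Submodule.smul_mem _ _ (Submodule.add_mem _
      (Finsupp.supported_mono (fun u hu => Dv_subset_Dv_add_single v i (by omega) hu) hG)
      (Finsupp.supported_mono (fun u hu => hu.1) (g G).2))
  · ext u
    rw [restrictF_apply, mul_one]
    split_ifs with hu
    · have hgu : (g G : (Fin (2 + 1) → ℤ) →₀ K) u = 0 := by
        by_contra hne
        have h1 := ((Finsupp.mem_supported K _).mp (g G).2 (Finsupp.mem_support_iff.mpr hne)).2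
        have h2 := (mem_Dfin.mp (mem_Dv.mp hu)).1 i
        rw [Pi.sub_apply] at h2
        omega
      simp [hgu]
    · have hGu : G u = 0 := by
        by_contra hne
        exact hu (hG (Finsupp.mem_support_iff.mpr hne))
      simp [hGu]
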